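/- arXiv:1505.02998 — 7 statements merged into one kernel-verified Lean document; each statement's English description precedes it below -/
import Mathlib

section
/- Let γ>1, ρ>0, c>0 and u=(u₁,u₂,u₃)∈ℝ³ satisfy 0<u₁<c and u₁²+u₂²+u₃²<c². For n∈ℝ³ let A(n) be the real symmetric 5×5 matrix in block form A(n)=[[(u·n)/(ρc²), nᵀ, 0],[n, ρ(u·n)I₃, 0],[0, 0, u·n]] (first block scalar, second 3×3, third scalar), and set A₁=A(e₁), A₂=A(e₂), A₃=A(e₃). Then A₁ is invertible, and for every (ξ,η)∈ℝ²∖{(0,0)} the quantity Δ:=(c²−u₁²)(ξ²+η²)−(u₂ξ+u₃η)² is strictly positive and the characteristic polynomial of the 5×5 matrix A₁⁻¹(A₂ξ+A₃η) equals (X−λ₀)³·((X−λ_R)²+λ_I²), where λ₀=(u₂ξ+u₃η)/u₁, λ_R=u₁(u₂ξ+u₃η)/(u₁²−c²) and λ_I=c·√Δ/(u₁²−c²)≠0. In particular this matrix has the real eigenvalue λ₀ with algebraic multiplicity three and the pair of simple non-real conjugate eigenvalues λ_R±iλ_I. -/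
open scoped BigOperators
open Polynomial

/-- The symmetric symbol matrix `A(n)` of the steady Euler system. -/
noncomputable def eulerSymbol (ρ c : ℝ) (u n : Fin 3 → ℝ) : Matrix (Fin 5) (Fin 5) ℝ :=
  !![(u 0 * n 0 + u 1 * n 1 + u 2 * n 2) / (ρ * c ^ 2), n 0, n 1, n 2, 0;
     n 0, ρ * (u 0 * n 0 + u 1 * n 1 + u 2 * n 2), 0, 0, 0;
     n 1, 0, ρ * (u 0 * n 0 + u 1 * n 1 + u 2 * n 2), 0, 0;
     n 2, 0, 0, ρ * (u 0 * n 0 + u 1 * n 1 + u 2 * n 2), 0;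
     0, 0, 0, 0, u 0 * n 0 + u 1 * n 1 + u 2 * n 2]

theorem eulerSymbol_linear_combination (ρ c : ℝ) (u : Fin 3 → ℝ) (x ξ η : ℝ) :
    x • eulerSymbol ρ c u ![1, 0, 0] -
        (ξ • eulerSymbol ρ c u ![0, 1, 0] + η • eulerSymbol ρ c u ![0, 0, 1]) =
      eulerSymbol ρ c u ![x, -ξ, -η] := by
  ext i j
  fin_cases i <;> fin_cases j <;> simp [eulerSymbol] <;> ring

theorem det_eulerSymbol {ρ c : ℝ} (hρ : ρ ≠ 0) (hc : c ≠ 0) (u n : Fin 3 → ℝ) :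
    (eulerSymbol ρ c u n).det =
      ρ ^ 2 * (u 0 * n 0 + u 1 * n 1 + u 2 * n 2) ^ 3 *
        ((u 0 * n 0 + u 1 * n 1 + u 2 * n 2) ^ 2 / c ^ 2 - (n 0 ^ 2 + n 1 ^ 2 + n 2 ^ 2)) := by
  unfold eulerSymbol
  generalize u 0 * n 0 + u 1 * n 1 + u 2 * n 2 = w
  simp [Matrix.det_succ_row_zero, Fin.sum_univ_succ, Fin.succAbove]
  field_simp
  ring

/-- The discriminant governing ellipticity is positive for subsonic flow. -/
theorem subsonic_discriminant_pos {c a b d ξ η : ℝ} (h : a ^ 2 + b ^ 2 + d ^ 2 < c ^ 2)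
    (hξη : (ξ, η) ≠ (0, 0)) :
    0 < (c ^ 2 - a ^ 2) * (ξ ^ 2 + η ^ 2) - (b * ξ + d * η) ^ 2 := by
  have hk : 0 < ξ ^ 2 + η ^ 2 := by
    rcases eq_or_ne ξ 0 with rfl | hξ
    · have : η ≠ 0 := fun hη => hξη (by rw [hη])
      positivity
    · positivity
  nlinarith [mul_pos (sub_pos.2 h) hk, sq_nonneg (b * η - d * ξ)]

theorem det_mul_eval_charpoly_inv_mul {n R : Type*} [Fintype n] [DecidableEq n] [CommRing R]
    {A : Matrix n n R} (hA : IsUnit A) (B : Matrix n n R) (x : R) :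
    A.det * (A⁻¹ * B).charpoly.eval x = (x • A - B).det := by
  rw [Matrix.eval_charpoly, ← Matrix.det_mul, mul_sub,
    Matrix.mul_nonsing_inv_cancel_left _ _ ((Matrix.isUnit_iff_isUnit_det A).1 hA),
    Matrix.scalar_apply, ← Matrix.smul_one_eq_diagonal, Matrix.mul_smul, mul_one]

/-- In the subsonic regime the steady Euler system is of elliptic-hyperbolic
composite-mixed type: `A₁` is invertible and `A₁⁻¹(A₂ξ + A₃η)` has characteristic
polynomial `(X - λ₀)³((X - λ_R)² + λ_I²)` with `λ_I ≠ 0`. -/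
theorem euler_composite_mixed_type
    (γ ρ c : ℝ) (u : Fin 3 → ℝ)
    (hγ : 1 < γ) (hρ : 0 < ρ) (hc : 0 < c)
    (hu1 : 0 < u 0) (hu1c : u 0 < c)
    (hsub : (u 0) ^ 2 + (u 1) ^ 2 + (u 2) ^ 2 < c ^ 2) :
    IsUnit (eulerSymbol ρ c u ![1, 0, 0]) ∧
    ∀ ξ η : ℝ, (ξ, η) ≠ (0, 0) →
      0 < (c ^ 2 - (u 0) ^ 2) * (ξ ^ 2 + η ^ 2) - (u 1 * ξ + u 2 * η) ^ 2 ∧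
      c * Real.sqrt ((c ^ 2 - (u 0) ^ 2) * (ξ ^ 2 + η ^ 2) - (u 1 * ξ + u 2 * η) ^ 2)
        / ((u 0) ^ 2 - c ^ 2) ≠ 0 ∧
      Matrix.charpoly
          ((eulerSymbol ρ c u ![1, 0, 0])⁻¹ *
            (ξ • eulerSymbol ρ c u ![0, 1, 0] + η • eulerSymbol ρ c u ![0, 0, 1]))
        = (X - C ((u 1 * ξ + u 2 * η) / u 0)) ^ 3 *
          ((X - C (u 0 * (u 1 * ξ + u 2 * η) / ((u 0) ^ 2 - c ^ 2))) ^ 2 +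
            C ((c * Real.sqrt ((c ^ 2 - (u 0) ^ 2) * (ξ ^ 2 + η ^ 2) - (u 1 * ξ + u 2 * η) ^ 2)
              / ((u 0) ^ 2 - c ^ 2)) ^ 2)) := by
  have hdet : (eulerSymbol ρ c u ![1, 0, 0]).det =
      ρ ^ 2 * u 0 ^ 3 * ((u 0 ^ 2 - c ^ 2) / c ^ 2) := by
    rw [det_eulerSymbol hρ.ne' hc.ne']
    simp only [Matrix.cons_val]
    field_simp
    ring
  have hneg : u 0 ^ 2 - c ^ 2 ≠ 0 := by nlinarith
  have hdet0 : (eulerSymbol ρ c u ![1, 0, 0]).det ≠ 0 := by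
    rw [hdet]
    positivity
  have hunit : IsUnit (eulerSymbol ρ c u ![1, 0, 0]) :=
    (Matrix.isUnit_iff_isUnit_det _).2 hdet0.isUnit
  refine ⟨hunit, fun ξ η hξη => ?_⟩
  have hΔ := subsonic_discriminant_pos hsub hξη
  refine ⟨hΔ, div_ne_zero (mul_ne_zero hc.ne' (Real.sqrt_pos.2 hΔ).ne') hneg, ?_⟩
  refine Polynomial.funext fun x => mul_left_cancel₀ hdet0 ?_
  rw [det_mul_eval_charpoly_inv_mul hunit, eulerSymbol_linear_combination,
    det_eulerSymbol hρ.ne' hc.ne', hdet, div_pow, mul_pow, Real.sq_sqrt hΔ.le]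
  have hu0 := hu1.ne'
  simp
  field_simp
  ring
end

section
/- Let a<b be real numbers, let P,Q,K,f:[a,b]→ℝ be continuous, and let α,h∈ℝ. Assume that the only twice continuously differentiable function w:[a,b]→ℝ satisfying the homogeneous nonlocal problem w''(t)+P(t)w'(t)+Q(t)w(t)=K(t)·w(a) on [a,b], w'(a)+αw(a)=0 and w(b)=0 is w≡0. Then there exists exactly one twice continuously differentiable function v:[a,b]→ℝ satisfying v''(t)+P(t)v'(t)+Q(t)v(t)=K(t)·v(a)+f(t) on [a,b], v'(a)+αv(a)=h and v(b)=0. -/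
open scoped BigOperators

/-- `v` solves the nonlocal two-point boundary value problem
`v'' + P v' + Q v = K·v(a) + f` on `[a,b]`, `v'(a) + α v(a) = h`, `v(b) = 0`. -/
def SolvesNonlocalBVP (a b : ℝ) (P Q K f : ℝ → ℝ) (α h : ℝ) (v : ℝ → ℝ) : Prop :=
  ContDiffOn ℝ 2 v (Set.Icc a b) ∧
  (∀ t ∈ Set.Icc a b,
      derivWithin (derivWithin v (Set.Icc a b)) (Set.Icc a b) t
        + P t * derivWithin v (Set.Icc a b) t + Q t * v t = K t * v a + f t) ∧
  derivWithin v (Set.Icc a b) a + α * v a = h ∧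
  v b = 0

open Set

/-- Coordinatewise projection of the plane onto the square `[-R, R] × [-R, R]`. -/
noncomputable def clampSquare (R : ℝ) (p : ℝ × ℝ) : ℝ × ℝ :=
  (max (min p.1 R) (-R), max (min p.2 R) (-R))

theorem lipschitzWith_clampSquare (R : ℝ) : LipschitzWith 1 (clampSquare R) := by
  have h : LipschitzWith 1 fun x : ℝ => max (min x R) (-R) :=
    (LipschitzWith.id.min_const R).max_const (-R)
  simpa using! LipschitzWith.prodMk (h.comp LipschitzWith.prod_fst) (h.comp LipschitzWith.prod_snd)

theorem norm_clampSquare_le {R : ℝ} (hR : 0 ≤ R) (p : ℝ × ℝ) : ‖clampSquare R p‖ ≤ R := by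
  have h (x : ℝ) : |max (min x R) (-R)| ≤ R :=
    abs_le.2 ⟨le_max_right _ _, max_le (min_le_right _ _) (by linarith)⟩
  exact max_le (h p.1) (h p.2)

theorem clampSquare_eq_self {R : ℝ} {p : ℝ × ℝ} (hp : ‖p‖ ≤ R) : clampSquare R p = p := by
  have h {x : ℝ} (hx : |x| ≤ R) : max (min x R) (-R) = x := by
    rw [min_eq_left (abs_le.1 hx).2, max_eq_left (abs_le.1 hx).1]
  exact Prod.ext (h ((norm_fst_le p).trans hp)) (h ((norm_snd_le p).trans hp))

/-- Global existence for an initial value problem in the plane whose vector field is globally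
Lipschitz in space. -/
theorem exists_hasDerivWithinAt_Icc_of_lipschitzWith {a b : ℝ} (hab : a ≤ b)
    {F : ℝ → ℝ × ℝ → ℝ × ℝ} {L : NNReal} (hL : ∀ t ∈ Icc a b, LipschitzWith L (F t))
    (hF : ∀ p, ContinuousOn (F · p) (Icc a b)) (p₀ : ℝ × ℝ) :
    ∃ u : ℝ → ℝ × ℝ, u a = p₀ ∧
      ∀ t ∈ Icc a b, HasDerivWithinAt u (F t (u t)) (Icc a b) t := by
  obtain ⟨G, hG⟩ := isCompact_Icc.exists_bound_of_continuousOn (hF 0)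
  have hG₀ : 0 ≤ G := (norm_nonneg _).trans (hG a (left_mem_Icc.2 hab))
  have hgrowth : ∀ t ∈ Icc a b, ∀ p, ‖F t p‖ ≤ L * ‖p‖ + G := fun t ht p => by
    have h₁ := (hL t ht).norm_sub_le p 0
    have h₂ := norm_sub_norm_le (F t p) (F t 0)
    have h₃ := hG t ht
    rw [sub_zero] at h₁
    linarith
  set R : ℝ := gronwallBound ‖p₀‖ L G (b - a)
  have hmono : Monotone (gronwallBound ‖p₀‖ L G) :=
    gronwallBound_mono (norm_nonneg _) hG₀ L.2
  have hR₀ : 0 ≤ R := by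
    have h := hmono (sub_nonneg.2 hab)
    rw [gronwallBound_x0] at h
    exact (norm_nonneg _).trans h
  have hB₀ : 0 ≤ L * R + G := by positivity
  have hpl : IsPicardLindelof (fun t p => F t (clampSquare R p))
      (⟨a, left_mem_Icc.2 hab⟩ : Icc a b) p₀
      (⟨L * R + G, hB₀⟩ * ⟨b - a, sub_nonneg.2 hab⟩) 0 ⟨L * R + G, hB₀⟩ L := by
    refine ⟨fun t ht => ?_, fun p _ => hF _, fun t ht p _ => ?_, ?_⟩
    · simpa using! ((hL t ht).comp (lipschitzWith_clampSquare R)).lipschitzOnWith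
    · refine (hgrowth t ht _).trans ?_
      change _ ≤ L * R + G
      have := norm_clampSquare_le hR₀ p
      gcongr
    · change (L * R + G) * max (b - a) (a - a) ≤ (L * R + G) * (b - a) - 0
      simp [sub_nonneg.2 hab]
  obtain ⟨u, hu₀, hu⟩ := hpl.exists_eq_forall_mem_Icc_hasDerivWithinAt₀
  refine ⟨u, hu₀, fun t ht => ?_⟩
  have hle : ∀ p, ‖clampSquare R p‖ ≤ ‖p‖ := fun p => by
    rcases le_total ‖p‖ R with h | h
    · rw [clampSquare_eq_self h]
    · exact (norm_clampSquare_le hR₀ p).trans h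
  have hbound : ‖u t‖ ≤ R := by
    refine (norm_le_gronwallBound_of_norm_deriv_right_le (δ := ‖p₀‖) (K := L) (ε := G)
      (fun s hs => (hu s hs).continuousWithinAt)
      (fun s hs => (hu s (Ico_subset_Icc_self hs)).mono_of_mem_nhdsWithin
        (Icc_mem_nhdsGE_of_mem hs)) (by simp [← hu₀]) (fun s hs => ?_) t ht).trans
      (hmono (by linarith [ht.2]))
    refine (hgrowth s (Ico_subset_Icc_self hs) _).trans ?_
    have := hle (u s)
    gcongr
  simpa only [clampSquare_eq_self hbound] using hu t ht

/-- Global existence for the initial value problem of a scalar second-order linear equation,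
written as a first-order system. -/
theorem exists_solution_second_order_linear {a b : ℝ} (hab : a ≤ b) {P Q g : ℝ → ℝ}
    (hP : ContinuousOn P (Icc a b)) (hQ : ContinuousOn Q (Icc a b))
    (hg : ContinuousOn g (Icc a b)) (c d : ℝ) :
    ∃ v w : ℝ → ℝ, v a = c ∧ w a = d ∧
      (∀ t ∈ Icc a b, HasDerivWithinAt v (w t) (Icc a b) t) ∧
      ∀ t ∈ Icc a b, HasDerivWithinAt w (g t - P t * w t - Q t * v t) (Icc a b) t := by
  obtain ⟨M, hM⟩ := isCompact_Icc.exists_bound_of_continuousOn hP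
  obtain ⟨N, hN⟩ := isCompact_Icc.exists_bound_of_continuousOn hQ
  have hM₀ : 0 ≤ M := (norm_nonneg _).trans (hM a (left_mem_Icc.2 hab))
  have hN₀ : 0 ≤ N := (norm_nonneg _).trans (hN a (left_mem_Icc.2 hab))
  have hL : ∀ t ∈ Icc a b, LipschitzWith ⟨M + N + 1, by positivity⟩
      fun p : ℝ × ℝ => (p.2, g t - P t * p.2 - Q t * p.1) := by
    refine fun t ht => LipschitzWith.of_dist_le_mul fun p q => ?_
    have h₁ : |p.1 - q.1| ≤ ‖p - q‖ := norm_fst_le (p - q)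
    have h₂ : |p.2 - q.2| ≤ ‖p - q‖ := norm_snd_le (p - q)
    have hn := norm_nonneg (p - q)
    rw [dist_eq_norm, dist_eq_norm]
    change max |p.2 - q.2|
      |g t - P t * p.2 - Q t * p.1 - (g t - P t * q.2 - Q t * q.1)| ≤ (M + N + 1) * ‖p - q‖
    refine max_le (by nlinarith) ?_
    calc |g t - P t * p.2 - Q t * p.1 - (g t - P t * q.2 - Q t * q.1)|
        = |P t * (p.2 - q.2) + Q t * (p.1 - q.1)| := by rw [← abs_neg]; congr 1; ring
      _ ≤ |P t| * |p.2 - q.2| + |Q t| * |p.1 - q.1| := by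
        rw [← abs_mul, ← abs_mul]; exact abs_add_le _ _
      _ ≤ M * ‖p - q‖ + N * ‖p - q‖ := by
        gcongr
        · exact hM t ht
        · exact hN t ht
      _ ≤ (M + N + 1) * ‖p - q‖ := by linarith
  obtain ⟨u, hu₀, hu⟩ :=
    exists_hasDerivWithinAt_Icc_of_lipschitzWith hab hL (fun p => by fun_prop) (c, d)
  refine ⟨fun t => (u t).1, fun t => (u t).2, by simp [hu₀], by simp [hu₀], fun t ht => ?_,
    fun t ht => ?_⟩
  · simpa using! (hu t ht).hasFDerivWithinAt.fst.hasDerivWithinAt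
  · simpa using! (hu t ht).hasFDerivWithinAt.snd.hasDerivWithinAt

/-- The boundary value problem, written as a first-order system. -/
theorem solvesNonlocalBVP_iff_exists {a b : ℝ} (hab : a < b) {P Q K f : ℝ → ℝ} {α h : ℝ}
    (hP : ContinuousOn P (Icc a b)) (hQ : ContinuousOn Q (Icc a b))
    (hK : ContinuousOn K (Icc a b)) (hf : ContinuousOn f (Icc a b)) {v : ℝ → ℝ} :
    SolvesNonlocalBVP a b P Q K f α h v ↔
      ∃ w : ℝ → ℝ, (∀ t ∈ Icc a b, HasDerivWithinAt v (w t) (Icc a b) t) ∧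
        (∀ t ∈ Icc a b,
          HasDerivWithinAt w (K t * v a + f t - P t * w t - Q t * v t) (Icc a b) t) ∧
        w a + α * v a = h ∧ v b = 0 := by
  have hs := uniqueDiffOn_Icc hab
  have h2 : (2 : WithTop ℕ∞) = 1 + 1 := by norm_num
  constructor
  · rintro ⟨hv, heq, hbc⟩
    rw [h2, contDiffOn_succ_iff_derivWithin hs] at hv
    refine ⟨derivWithin v (Icc a b), fun t ht => (hv.1 t ht).hasDerivWithinAt, fun t ht => ?_,
      hbc⟩
    exact ((hv.2.2.differentiableOn one_ne_zero) t ht).hasDerivWithinAt.congr_deriv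
      (by linarith [heq t ht])
  · rintro ⟨w, hv, hw, hbc⟩
    have hvw : EqOn (derivWithin v (Icc a b)) w (Icc a b) :=
      fun t ht => (hv t ht).derivWithin (hs t ht)
    have hw' : EqOn (derivWithin w (Icc a b))
        (fun t => K t * v a + f t - P t * w t - Q t * v t) (Icc a b) :=
      fun t ht => (hw t ht).derivWithin (hs t ht)
    have hvc : ContinuousOn v (Icc a b) := fun t ht => (hv t ht).continuousWithinAt
    have hwc : ContinuousOn w (Icc a b) := fun t ht => (hw t ht).continuousWithinAt
    refine ⟨?_, fun t ht => ?_, ?_, hbc.2⟩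
    · rw [h2, contDiffOn_succ_iff_derivWithin hs]
      refine ⟨fun t ht => (hv t ht).differentiableWithinAt, by simp, ContDiffOn.congr ?_ hvw⟩
      rw [contDiffOn_one_iff_derivWithin hs]
      exact ⟨fun t ht => (hw t ht).differentiableWithinAt, ContinuousOn.congr (by fun_prop) hw'⟩
    · rw [derivWithin_congr hvw (hvw ht), hw' ht, hvw ht]
      ring
    · rw [hvw (left_mem_Icc.2 hab.le)]
      exact hbc.1

/-- Unique solvability of the two-point boundary value problem for a second-order
linear ODE with a nonlocal term `K(t)·v(a)`, assuming the homogeneous problem admits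
only the trivial solution. -/
theorem nonlocal_bvp_unique_solvability
    (a b : ℝ) (hab : a < b) (P Q K f : ℝ → ℝ) (α h : ℝ)
    (hP : ContinuousOn P (Set.Icc a b)) (hQ : ContinuousOn Q (Set.Icc a b))
    (hK : ContinuousOn K (Set.Icc a b)) (hf : ContinuousOn f (Set.Icc a b))
    (huniq : ∀ w : ℝ → ℝ, SolvesNonlocalBVP a b P Q K (fun _ => 0) α 0 w →
      ∀ t ∈ Set.Icc a b, w t = 0) :
    ∃ v : ℝ → ℝ, SolvesNonlocalBVP a b P Q K f α h v ∧
      ∀ v' : ℝ → ℝ, SolvesNonlocalBVP a b P Q K f α h v' →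
        ∀ t ∈ Set.Icc a b, v' t = v t := by
  have ha : a ∈ Icc a b := left_mem_Icc.2 hab.le
  have hz : ContinuousOn (fun _ : ℝ => (0 : ℝ)) (Icc a b) := continuousOn_const
  obtain ⟨y, y', hya, hya', hy, hy'⟩ :=
    exists_solution_second_order_linear hab.le hP hQ hf 0 h
  obtain ⟨z, z', hza, hza', hzd, hzd'⟩ :=
    exists_solution_second_order_linear hab.le hP hQ hK 1 (-α)
  have hzb : z b ≠ 0 := fun hzb => by
    have hsol : SolvesNonlocalBVP a b P Q K (fun _ => 0) α 0 z :=
      (solvesNonlocalBVP_iff_exists hab hP hQ hK hz).2 ⟨z', hzd, fun t ht => by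
        simpa [hza] using hzd' t ht, by simp [hza, hza'], hzb⟩
    exact one_ne_zero (hza.symm.trans (huniq z hsol a ha))
  set c : ℝ := -y b / z b with hc
  have hv : SolvesNonlocalBVP a b P Q K f α h (fun t => y t + c * z t) := by
    refine (solvesNonlocalBVP_iff_exists hab hP hQ hK hf).2
      ⟨fun t => y' t + c * z' t, fun t ht => (hy t ht).fun_add ((hzd t ht).const_mul c),
        fun t ht => ?_, ?_, ?_⟩
    · refine ((hy' t ht).fun_add ((hzd' t ht).const_mul c)).congr_deriv ?_
      rw [hya, hza]
      ring
    · simp only [hya, hya', hza, hza']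
      ring
    · simp only [hc]
      field_simp
      ring
  refine ⟨_, hv, fun v' hv' t ht => ?_⟩
  obtain ⟨w, hw, hwd, hwa, hwb⟩ := (solvesNonlocalBVP_iff_exists hab hP hQ hK hf).1 hv
  obtain ⟨w', hw', hwd', hwa', hwb'⟩ := (solvesNonlocalBVP_iff_exists hab hP hQ hK hf).1 hv'
  refine sub_eq_zero.1 (huniq (fun s => v' s - (y s + c * z s))
    ((solvesNonlocalBVP_iff_exists hab hP hQ hK hz).2 ⟨fun s => w' s - w s,
      fun s hs => (hw' s hs).fun_sub (hw s hs), fun s hs => ?_, by linarith, by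
        simp only [hwb, hwb', sub_zero]⟩) t ht)
  exact ((hwd' s hs).fun_sub (hwd s hs)).congr_deriv (by ring)
end

section
/- Let Ω⊆ℝ³ be open, u:Ω→ℝ³ twice continuously differentiable, p:Ω→ℝ twice continuously differentiable, ρ:Ω→ℝ continuously differentiable with ρ≠0, and b:Ω→ℝ³ continuously differentiable. Suppose the momentum balance (u·∇)u + ∇p/ρ = b holds in Ω. Define the vorticity components ω_{km}:=∂_ku_m−∂_mu_k for k,m∈{1,2,3}. Then for all k,m∈{1,2,3} and all points of Ω: Σ_{j=1}^3 [u_j∂_jω_{km} + ω_{jm}∂_ku_j + ω_{kj}∂_mu_j] = ∂_m(1/ρ)·∂_kp − ∂_k(1/ρ)·∂_mp + ∂_kb_m − ∂_mb_k. (This is the coordinate form of the vorticity transport law 𝓛_u(dū) = −d(1/ρ)∧dp + db̄.) -/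
open scoped BigOperators

/-- Partial derivative `∂ⱼ f` at `x`. -/
noncomputable def pd (j : Fin 3) (f : (Fin 3 → ℝ) → ℝ) (x : Fin 3 → ℝ) : ℝ :=
  fderiv ℝ f x (Pi.single j 1)

/-- Vorticity components `ω_{km} = ∂ₖu_m − ∂_mu_k`. -/
noncomputable def vort (u : (Fin 3 → ℝ) → Fin 3 → ℝ) (k m : Fin 3) (x : Fin 3 → ℝ) : ℝ :=
  pd k (fun y => u y m) x - pd m (fun y => u y k) x

theorem pd_add {f g : (Fin 3 → ℝ) → ℝ} {x : Fin 3 → ℝ} (k : Fin 3)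
    (hf : DifferentiableAt ℝ f x) (hg : DifferentiableAt ℝ g x) :
    pd k (fun y => f y + g y) x = pd k f x + pd k g x := by
  simp [pd, fderiv_fun_add hf hg]

theorem pd_sub {f g : (Fin 3 → ℝ) → ℝ} {x : Fin 3 → ℝ} (k : Fin 3)
    (hf : DifferentiableAt ℝ f x) (hg : DifferentiableAt ℝ g x) :
    pd k (fun y => f y - g y) x = pd k f x - pd k g x := by
  simp [pd, fderiv_fun_sub hf hg]

theorem pd_mul {f g : (Fin 3 → ℝ) → ℝ} {x : Fin 3 → ℝ} (k : Fin 3)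
    (hf : DifferentiableAt ℝ f x) (hg : DifferentiableAt ℝ g x) :
    pd k (fun y => f y * g y) x = pd k f x * g x + f x * pd k g x := by
  simp [pd, fderiv_fun_mul hf hg]
  ring

theorem pd_sum {ι : Type*} (s : Finset ι) {f : ι → (Fin 3 → ℝ) → ℝ} {x : Fin 3 → ℝ}
    (k : Fin 3) (hf : ∀ j ∈ s, DifferentiableAt ℝ (f j) x) :
    pd k (fun y => ∑ j ∈ s, f j y) x = ∑ j ∈ s, pd k (f j) x := by
  simp [pd, fderiv_fun_sum hf]

theorem pd_congr {f g : (Fin 3 → ℝ) → ℝ} {x : Fin 3 → ℝ} (k : Fin 3)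
    (h : f =ᶠ[nhds x] g) : pd k f x = pd k g x := by
  simp [pd, h.fderiv_eq]

theorem ContDiffAt.differentiableAt_pd {f : (Fin 3 → ℝ) → ℝ} {x : Fin 3 → ℝ}
    (hf : ContDiffAt ℝ 2 f x) (k : Fin 3) : DifferentiableAt ℝ (pd k f) x :=
  ((hf.fderiv_right (m := 1) (by norm_num)).differentiableAt one_ne_zero).clm_apply
    (differentiableAt_const _)

theorem pd_pd_eq_fderiv_fderiv {f : (Fin 3 → ℝ) → ℝ} {x : Fin 3 → ℝ}
    (hf : ContDiffAt ℝ 2 f x) (j k : Fin 3) :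
    pd j (pd k f) x = fderiv ℝ (fderiv ℝ f) x (Pi.single j 1) (Pi.single k 1) := by
  have hd := (hf.fderiv_right (m := 1) (by norm_num)).differentiableAt one_ne_zero
  change fderiv ℝ (fun y => fderiv ℝ f y (Pi.single k 1)) x (Pi.single j 1) = _
  rw [fderiv_clm_apply hd (differentiableAt_const _)]
  simp

/-- Symmetry of second partial derivatives. -/
theorem pd_comm {f : (Fin 3 → ℝ) → ℝ} {x : Fin 3 → ℝ}
    (hf : ContDiffAt ℝ 2 f x) (j k : Fin 3) :
    pd j (pd k f) x = pd k (pd j f) x := by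
  rw [pd_pd_eq_fderiv_fderiv hf, pd_pd_eq_fderiv_fderiv hf]
  exact (hf.isSymmSndFDerivAt (by simp)).eq _ _

/-- Vorticity transport law (coordinate form of `𝓛_u(dū) = −d(1/ρ)∧dp + db̄`):
if `(u·∇)u + ∇p/ρ = b` in `Ω`, then
`Σⱼ [uⱼ∂ⱼω_{km} + ω_{jm}∂ₖuⱼ + ω_{kj}∂_muⱼ]
  = ∂_m(1/ρ)∂ₖp − ∂ₖ(1/ρ)∂_mp + ∂ₖb_m − ∂_mb_k`. -/
theorem vorticity_transport
    (Ω : Set (Fin 3 → ℝ)) (hΩ : IsOpen Ω)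
    (u b : (Fin 3 → ℝ) → Fin 3 → ℝ) (p ρ : (Fin 3 → ℝ) → ℝ)
    (hu : ContDiffOn ℝ 2 u Ω) (hp : ContDiffOn ℝ 2 p Ω)
    (hρ : ContDiffOn ℝ 1 ρ Ω) (hρ0 : ∀ x ∈ Ω, ρ x ≠ 0)
    (hb : ContDiffOn ℝ 1 b Ω)
    (hmom : ∀ x ∈ Ω, ∀ i,
      (∑ j, u x j * pd j (fun y => u y i) x) + pd i p x / ρ x = b x i) :
    ∀ x ∈ Ω, ∀ k m : Fin 3,
      (∑ j, (u x j * pd j (fun y => vort u k m y) x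
          + vort u j m x * pd k (fun y => u y j) x
          + vort u k j x * pd m (fun y => u y j) x))
        = pd m (fun y => 1 / ρ y) x * pd k p x - pd k (fun y => 1 / ρ y) x * pd m p x
          + pd k (fun y => b y m) x - pd m (fun y => b y k) x := by
  intro x hx k m
  have hΩx : Ω ∈ nhds x := hΩ.mem_nhds hx
  have huc (i : Fin 3) : ContDiffAt ℝ 2 (fun y => u y i) x :=
    contDiffAt_pi.1 (hu.contDiffAt hΩx) i
  have hpc : ContDiffAt ℝ 2 p x := hp.contDiffAt hΩx
  have hud (i : Fin 3) : DifferentiableAt ℝ (fun y => u y i) x :=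
    (huc i).differentiableAt two_ne_zero
  have hrd : DifferentiableAt ℝ (fun y => 1 / ρ y) x := by
    simpa only [one_div] using
      ((hρ.contDiffAt hΩx).differentiableAt one_ne_zero).fun_inv (hρ0 x hx)
  have hbd (k i : Fin 3) : pd k (fun y => b y i) x
      = (∑ j, (pd k (fun y => u y j) x * pd j (fun y => u y i) x
          + u x j * pd j (pd k (fun y => u y i)) x))
        + (pd k (pd i p) x * (1 / ρ x) + pd i p x * pd k (fun y => 1 / ρ y) x) := by
    have hev : (fun y => b y i) =ᶠ[nhds x]
        fun y => (∑ j, u y j * pd j (fun z => u z i) y) + pd i p y * (1 / ρ y) := by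
      filter_upwards [hΩx] with y hy
      rw [← hmom y hy i, mul_one_div]
    have hprod (j : Fin 3) :
        DifferentiableAt ℝ (fun y => u y j * pd j (fun z => u z i) y) x :=
      (hud j).mul ((huc i).differentiableAt_pd j)
    rw [pd_congr k hev,
      pd_add k (DifferentiableAt.fun_sum fun j _ => hprod j) ((hpc.differentiableAt_pd i).fun_mul hrd),
      pd_sum _ k (fun j _ => hprod j), pd_mul k (hpc.differentiableAt_pd i) hrd]
    congr 1
    refine Finset.sum_congr rfl fun j _ => ?_
    rw [pd_mul k (hud j) ((huc i).differentiableAt_pd j), pd_comm (huc i) k j]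
  have hvort (j : Fin 3) : pd j (fun y => vort u k m y) x
      = pd j (pd k (fun y => u y m)) x - pd j (pd m (fun y => u y k)) x :=
    pd_sub j ((huc m).differentiableAt_pd k) ((huc k).differentiableAt_pd m)
  simp only [hbd, hvort, pd_comm hpc k m, Fin.sum_univ_three]
  simp only [vort]
  ring
end

section
/- Let γ>1 and 0<r₀<r₁. Let u,ρ,p:[r₀,r₁]→ℝ be differentiable with u(r)>0, ρ(r)>0, p(r)>0 and u(r)²≠c(r)²:=γp(r)/ρ(r) for all r, and suppose (u,ρ,p) solves the radial ODE system. Then the Mach number M:=u/c is differentiable and satisfies M'(r) = M(r)(2+(γ−1)M(r)²)/(r(M(r)²−1)) for every r∈[r₀,r₁]. -/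
open scoped BigOperators

/-- The radial ODE system of spherically symmetric steady Euler flow on `[r₀, r₁]`,
with `c² = γp/ρ`:
`u' = 2c²u/(r(u²−c²))`, `ρ' = −2ρu²/(r(u²−c²))`, `p' = −2ρc²u²/(r(u²−c²))`. -/
def RadialEuler (γ r₀ r₁ : ℝ) (u ρ p : ℝ → ℝ) : Prop :=
  ∀ r ∈ Set.Icc r₀ r₁,
    HasDerivWithinAt u
      (2 * (γ * p r / ρ r) * u r / (r * ((u r) ^ 2 - γ * p r / ρ r)))
      (Set.Icc r₀ r₁) r ∧
    HasDerivWithinAt ρ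
      (-(2 * ρ r * (u r) ^ 2) / (r * ((u r) ^ 2 - γ * p r / ρ r)))
      (Set.Icc r₀ r₁) r ∧
    HasDerivWithinAt p
      (-(2 * ρ r * (γ * p r / ρ r) * (u r) ^ 2) / (r * ((u r) ^ 2 - γ * p r / ρ r)))
      (Set.Icc r₀ r₁) r

/-- The Mach number `M = u/c` of a radial Euler flow satisfies
`M' = M(2+(γ−1)M²)/(r(M²−1))`. -/
theorem mach_number_ode
    (γ r₀ r₁ : ℝ) (u ρ p : ℝ → ℝ)
    (hγ : 1 < γ) (h0 : 0 < r₀) (h01 : r₀ < r₁)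
    (hu : ∀ r ∈ Set.Icc r₀ r₁, 0 < u r)
    (hρ : ∀ r ∈ Set.Icc r₀ r₁, 0 < ρ r)
    (hp : ∀ r ∈ Set.Icc r₀ r₁, 0 < p r)
    (hns : ∀ r ∈ Set.Icc r₀ r₁, (u r) ^ 2 ≠ γ * p r / ρ r)
    (hode : RadialEuler γ r₀ r₁ u ρ p) :
    ∀ r ∈ Set.Icc r₀ r₁,
      HasDerivWithinAt (fun t => u t / Real.sqrt (γ * p t / ρ t))
        ((u r / Real.sqrt (γ * p r / ρ r))
            * (2 + (γ - 1) * (u r / Real.sqrt (γ * p r / ρ r)) ^ 2)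
          / (r * ((u r / Real.sqrt (γ * p r / ρ r)) ^ 2 - 1)))
        (Set.Icc r₀ r₁) r := by
  intro r hr
  obtain ⟨h₁, h₂, h₃⟩ := hode r hr
  have hr₀ : r ≠ 0 := (h0.trans_le hr.1).ne'
  have hρr : ρ r ≠ 0 := (hρ r hr).ne'
  have hq : 0 < γ * p r / ρ r :=
    div_pos (mul_pos (by linarith) (hp r hr)) (hρ r hr)
  have hne := hns r hr
  have hs : 0 < Real.sqrt (γ * p r / ρ r) := Real.sqrt_pos.2 hq
  refine (h₁.div (((h₃.const_mul γ).div h₂ hρr).sqrt hq.ne') hs.ne').congr_deriv ?_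
  have hsq : γ * p r / ρ r = Real.sqrt (γ * p r / ρ r) ^ 2 := (Real.sq_sqrt hq.le).symm
  simp only [Pi.div_apply]
  generalize Real.sqrt (γ * p r / ρ r) = s at hs hsq ⊢
  have hγp : γ * p r = s ^ 2 * ρ r := by rw [← hsq]; field_simp
  rw [hsq] at hne
  have hd : u r ^ 2 - s ^ 2 ≠ 0 := sub_ne_zero.2 hne
  have hM : (u r / s) ^ 2 - 1 = (u r ^ 2 - s ^ 2) / s ^ 2 := by field_simp
  rw [hsq, hγp, hM]
  field_simp
  ring
end

section
/- Let γ>1 and 0<r₀<r₁. Let M:[r₀,r₁]→ℝ be differentiable with M(r)>0 and M(r)≠1 for all r, and suppose M'(r) = M(r)(2+(γ−1)M(r)²)/(r(M(r)²−1)) on [r₀,r₁]. Then the function r ↦ r·√(M(r))·(2+(γ−1)M(r)²)^{−(1/4+1/(2(γ−1)))} is constant on [r₀,r₁]; equivalently, there is a constant c₁ with r = c₁·(2+(γ−1)M(r)²)^{1/4+1/(2(γ−1))}/√(M(r)) for all r. -/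
open scoped BigOperators

/-- Along a solution of the Mach-number equation, the logarithm of the first integral has
derivative zero. -/
lemma hasDerivWithinAt_log_mach_integral {γ r : ℝ} {M : ℝ → ℝ} {s : Set ℝ}
    (hγ : 1 < γ) (hr : 0 < r) (hM : 0 < M r) (hM1 : M r ≠ 1)
    (hode : HasDerivWithinAt M
      (M r * (2 + (γ - 1) * (M r) ^ 2) / (r * ((M r) ^ 2 - 1))) s r) :
    HasDerivWithinAt (fun x => Real.log x + 1 / 2 * Real.log (M x)
      - (1 / 4 + 1 / (2 * (γ - 1))) * Real.log (2 + (γ - 1) * (M x) ^ 2)) 0 s r := by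
  have hg : 0 < γ - 1 := sub_pos.2 hγ
  have hP : 0 < 2 + (γ - 1) * (M r) ^ 2 := by positivity
  have hQ : (M r) ^ 2 - 1 ≠ 0 := by
    intro h
    have : (M r - 1) * (M r + 1) = 0 := by linarith
    rcases mul_eq_zero.1 this with h | h
    · exact hM1 (by linarith)
    · linarith
  have hPd := (((hode.pow 2).const_mul (γ - 1)).const_add 2).log hP.ne'
  have h := (((Real.hasDerivAt_log hr.ne').hasDerivWithinAt (s := s)).add
    ((hode.log hM.ne').const_mul (1 / 2))).sub
      (hPd.const_mul (1 / 4 + 1 / (2 * (γ - 1))))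
  refine h.congr_deriv ?_
  simp only [Pi.pow_apply]
  field_simp
  ring

/-- The first integral is the exponential of its logarithm. -/
lemma exp_log_mach_integral {r m p a : ℝ} (hr : 0 < r) (hm : 0 < m) (hp : 0 < p) :
    Real.exp (Real.log r + 1 / 2 * Real.log m - a * Real.log p)
      = r * Real.sqrt m * p ^ (-a) := by
  rw [sub_eq_add_neg, Real.exp_add, Real.exp_add, Real.exp_log hr, Real.sqrt_eq_rpow,
    Real.rpow_def_of_pos hm, Real.rpow_def_of_pos hp]
  ring_nf

/-- First integral of the Mach-number ODE: if
`M' = M(2+(γ−1)M²)/(r(M²−1))` on `[r₀,r₁]`, then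
`r·√M·(2+(γ−1)M²)^{−(1/4+1/(2(γ−1)))}` is constant; equivalently
`r = c₁(2+(γ−1)M²)^{1/4+1/(2(γ−1))}/√M`. -/
theorem mach_ode_first_integral
    (γ r₀ r₁ : ℝ) (M : ℝ → ℝ)
    (hγ : 1 < γ) (h0 : 0 < r₀) (h01 : r₀ < r₁)
    (hM : ∀ r ∈ Set.Icc r₀ r₁, 0 < M r)
    (hM1 : ∀ r ∈ Set.Icc r₀ r₁, M r ≠ 1)
    (hode : ∀ r ∈ Set.Icc r₀ r₁,
      HasDerivWithinAt M
        (M r * (2 + (γ - 1) * (M r) ^ 2) / (r * ((M r) ^ 2 - 1)))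
        (Set.Icc r₀ r₁) r) :
    (∀ r ∈ Set.Icc r₀ r₁, ∀ r' ∈ Set.Icc r₀ r₁,
      r * Real.sqrt (M r) *
          (2 + (γ - 1) * (M r) ^ 2) ^ (-(1 / 4 + 1 / (2 * (γ - 1))) : ℝ)
        = r' * Real.sqrt (M r') *
          (2 + (γ - 1) * (M r') ^ 2) ^ (-(1 / 4 + 1 / (2 * (γ - 1))) : ℝ)) ∧
    ∃ c₁ : ℝ, ∀ r ∈ Set.Icc r₀ r₁,
      r = c₁ * (2 + (γ - 1) * (M r) ^ 2) ^ ((1 / 4 + 1 / (2 * (γ - 1))) : ℝ)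
        / Real.sqrt (M r) := by
  have hpos : ∀ r ∈ Set.Icc r₀ r₁, 0 < r := fun r hr => h0.trans_le hr.1
  have hP : ∀ r, 0 < 2 + (γ - 1) * (M r) ^ 2 := fun r => by
    have : 0 < γ - 1 := sub_pos.2 hγ
    positivity
  have hd := fun r hr =>
    hasDerivWithinAt_log_mach_integral hγ (hpos r hr) (hM r hr) (hM1 r hr) (hode r hr)
  have hlog := constant_of_derivWithin_zero (fun r hr => (hd r hr).differentiableWithinAt)
    (fun r hr => (hd r (Set.Ico_subset_Icc_self hr)).derivWithin
      (uniqueDiffOn_Icc h01 r (Set.Ico_subset_Icc_self hr)))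
  have hconst : ∀ r ∈ Set.Icc r₀ r₁, ∀ r' ∈ Set.Icc r₀ r₁,
      r * Real.sqrt (M r) *
          (2 + (γ - 1) * (M r) ^ 2) ^ (-(1 / 4 + 1 / (2 * (γ - 1))) : ℝ)
        = r' * Real.sqrt (M r') *
          (2 + (γ - 1) * (M r') ^ 2) ^ (-(1 / 4 + 1 / (2 * (γ - 1))) : ℝ) := by
    intro r hr r' hr'
    rw [← exp_log_mach_integral (hpos r hr) (hM r hr) (hP r),
      ← exp_log_mach_integral (hpos r' hr') (hM r' hr') (hP r')]
    exact congrArg Real.exp ((hlog r hr).trans (hlog r' hr').symm)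
  refine ⟨hconst, r₀ * Real.sqrt (M r₀) *
    (2 + (γ - 1) * (M r₀) ^ 2) ^ (-(1 / 4 + 1 / (2 * (γ - 1))) : ℝ), fun r hr => ?_⟩
  rw [← hconst r hr r₀ (Set.left_mem_Icc.2 h01.le), Real.rpow_neg (hP r).le]
  have h1 := (Real.sqrt_pos.2 (hM r hr)).ne'
  have h2 := (Real.rpow_pos_of_pos (hP r) (1 / 4 + 1 / (2 * (γ - 1)))).ne'
  rw [mul_assoc, inv_mul_cancel₀ h2, mul_one, mul_div_cancel_right₀ _ h1]
end

section
/- Let γ>1 and 0<r₀<r₁. Let M:[r₀,r₁]→ℝ be differentiable with M(r)>0 and M(r)≠1 for all r, satisfying M'(r) = M(r)(2+(γ−1)M(r)²)/(r(M(r)²−1)) on [r₀,r₁], and suppose M(r₀)<1. Then M(r)<1 for every r∈[r₀,r₁], M is strictly decreasing, and 0<M(r)<M(r₀)<1 for every r∈(r₀,r₁]. (In particular, a spherically symmetric flow that is subsonic at the entry remains subsonic throughout.) -/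
open scoped BigOperators

/-- A spherically symmetric flow that is subsonic at the entry stays subsonic:
if `M' = M(2+(γ−1)M²)/(r(M²−1))` on `[r₀,r₁]` with `M > 0`, `M ≠ 1`, and `M(r₀) < 1`,
then `M < 1` everywhere, `M` is strictly decreasing, and `0 < M(r) < M(r₀) < 1`
for `r ∈ (r₀, r₁]`. -/
theorem subsonic_entry_stays_subsonic
    (γ r₀ r₁ : ℝ) (M : ℝ → ℝ)
    (hγ : 1 < γ) (h0 : 0 < r₀) (h01 : r₀ < r₁)
    (hM : ∀ r ∈ Set.Icc r₀ r₁, 0 < M r)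
    (hM1 : ∀ r ∈ Set.Icc r₀ r₁, M r ≠ 1)
    (hode : ∀ r ∈ Set.Icc r₀ r₁,
      HasDerivWithinAt M
        (M r * (2 + (γ - 1) * (M r) ^ 2) / (r * ((M r) ^ 2 - 1)))
        (Set.Icc r₀ r₁) r)
    (hsub : M r₀ < 1) :
    (∀ r ∈ Set.Icc r₀ r₁, M r < 1) ∧
    StrictAntiOn M (Set.Icc r₀ r₁) ∧
    (∀ r ∈ Set.Ioc r₀ r₁, 0 < M r ∧ M r < M r₀ ∧ M r₀ < 1) := by
  have hcont : ContinuousOn M (Set.Icc r₀ r₁) := fun r hr => (hode r hr).continuousWithinAt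
  have hlt : ∀ r ∈ Set.Icc r₀ r₁, M r < 1 := by
    intro r hr
    by_contra! hge
    obtain ⟨s, hs, hs1⟩ := intermediate_value_Icc hr.1
      (hcont.mono (Set.Icc_subset_Icc_right hr.2)) ⟨hsub.le, hge⟩
    exact hM1 s ⟨hs.1, hs.2.trans hr.2⟩ hs1
  have hanti : StrictAntiOn M (Set.Icc r₀ r₁) := by
    refine strictAntiOn_of_hasDerivWithinAt_neg (convex_Icc r₀ r₁) hcont
      (fun r hr => (hode r (interior_subset hr)).mono interior_subset) fun r hr => ?_
    have hr' := interior_subset hr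
    have hpos := hM r hr'
    have hr0 : 0 < r := h0.trans_le hr'.1
    have hγ' : 0 < γ - 1 := sub_pos.mpr hγ
    have hsq : M r ^ 2 - 1 < 0 := by nlinarith [hlt r hr']
    exact div_neg_of_pos_of_neg (by positivity) (mul_neg_of_pos_of_neg hr0 hsq)
  exact ⟨hlt, hanti, fun r hr => ⟨hM r (Set.Ioc_subset_Icc_self hr),
    hanti (Set.left_mem_Icc.mpr h01.le) (Set.Ioc_subset_Icc_self hr) hr.1, hsub⟩⟩
end

section
/- Let γ>1, 0<r₀<r₁, and let p₀>0, A₁>0 and E₁∈ℝ satisfy E₁ > (γ/(γ−1))·A₁^{1/γ}·p₀^{(γ−1)/γ} and p₀ > ((2/γ)·((γ−1)/(γ+1)))^{γ/(γ−1)} · E₁^{γ/(γ−1)} · A₁^{−1/(γ−1)}. Set ρ₀:=(p₀/A₁)^{1/γ}, c₀²:=γp₀/ρ₀ and u₀:=√(2(E₁−c₀²/(γ−1)))>0. Then there exists exactly one triple (u,ρ,p) of continuously differentiable functions on [r₀,r₁] with ρ(r)>0, p(r)>0 and 0<u(r)<c(r):=√(γp(r)/ρ(r)) for all r, solving the radial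 ODE system with initial data u(r₀)=u₀, ρ(r₀)=ρ₀, p(r₀)=p₀. Moreover u, ρ and p are real analytic on [r₀,r₁]. -/
open scoped BigOperators

/-- `(u,ρ,p)` is a `C¹`, everywhere subsonic (`0 < u < c`) positive solution of the
radial ODE system on `[r₀,r₁]` with initial data `(u₀,ρ₀,p₀)` at `r₀`. -/
def IsSubsonicRadialSolution (γ r₀ r₁ u₀ ρ₀ p₀ : ℝ) (u ρ p : ℝ → ℝ) : Prop :=
  ContDiffOn ℝ 1 u (Set.Icc r₀ r₁) ∧ ContDiffOn ℝ 1 ρ (Set.Icc r₀ r₁) ∧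
  ContDiffOn ℝ 1 p (Set.Icc r₀ r₁) ∧
  (∀ r ∈ Set.Icc r₀ r₁,
      0 < ρ r ∧ 0 < p r ∧ 0 < u r ∧ u r < Real.sqrt (γ * p r / ρ r)) ∧
  RadialEuler γ r₀ r₁ u ρ p ∧
  u r₀ = u₀ ∧ ρ r₀ = ρ₀ ∧ p r₀ = p₀

open Set Filter Topology

/-- A function which is injective on an open set `s` and analytic with nonzero derivative at a point
of `s` has an analytic inverse there. -/
lemma AnalyticAt.analyticAt_invFunOn {f : ℝ → ℝ} {s : Set ℝ} {x : ℝ} (hf : AnalyticAt ℝ f x)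
    (hf' : deriv f x ≠ 0) (hs : IsOpen s) (hinj : InjOn f s) (hx : x ∈ s) :
    AnalyticAt ℝ (Function.invFunOn f s) (f x) := by
  refine (analyticAt_comp_iff_of_deriv_ne_zero hf hf').1 (analyticAt_id.congr ?_)
  filter_upwards [hs.mem_nhds hx] with z hz using (hinj.leftInvOn_invFunOn hz).symm

/-- The speeds `u > 0` at which a flow with Bernoulli constant `E` is subsonic, where
`k = 1 / (γ - 1)` and the squared sound speed is `(E - u² / 2) / k`. -/
def subsonicSpeeds (E k : ℝ) : Set ℝ := {u | 0 < u ∧ k * u ^ 2 + u ^ 2 / 2 < E}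

/-- Up to an additive constant, the logarithm of the mass flux `ρ u` at speed `u` of a flow with
Bernoulli constant `E`, where `k = 1 / (γ - 1)`. -/
noncomputable def logMassFlux (E k u : ℝ) : ℝ := Real.log u + k * Real.log (E - u ^ 2 / 2)

section logMassFlux

variable {E k u : ℝ}

lemma isOpen_subsonicSpeeds : IsOpen (subsonicSpeeds E k) := by
  unfold subsonicSpeeds
  exact (isOpen_lt (by fun_prop) (by fun_prop)).and (isOpen_lt (by fun_prop) (by fun_prop))

lemma mem_subsonicSpeeds_of_le {v : ℝ} (hk : 0 < k) (hu : u ∈ subsonicSpeeds E k) (hv : 0 < v)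
    (hvu : v ≤ u) : v ∈ subsonicSpeeds E k := by
  have h : v ^ 2 ≤ u ^ 2 := by gcongr
  have h' := mul_le_mul_of_nonneg_left h hk.le
  exact ⟨hv, by linarith [hu.2]⟩

lemma convex_subsonicSpeeds (hk : 0 < k) : Convex ℝ (subsonicSpeeds E k) := by
  rw [convex_iff_ordConnected]
  exact ⟨fun x hx y hy z hz ↦ mem_subsonicSpeeds_of_le hk hy (hx.1.trans_le hz.1) hz.2⟩

lemma enthalpy_pos (hk : 0 < k) (hu : u ∈ subsonicSpeeds E k) : 0 < E - u ^ 2 / 2 := by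
  have := mul_pos hk (pow_pos hu.1 2)
  linarith [hu.2]

lemma analyticAt_logMassFlux (hk : 0 < k) (hu : u ∈ subsonicSpeeds E k) :
    AnalyticAt ℝ (logMassFlux E k) u :=
  (analyticAt_log hu.1).add
    (analyticAt_const.mul (AnalyticAt.log (by fun_prop) (enthalpy_pos hk hu)))

lemma hasDerivAt_logMassFlux (hk : 0 < k) (hu : u ∈ subsonicSpeeds E k) :
    HasDerivAt (logMassFlux E k) (u⁻¹ - k * u / (E - u ^ 2 / 2)) u := by
  have h := enthalpy_pos hk hu
  have hE : HasDerivAt (fun v : ℝ ↦ E - v ^ 2 / 2) (-u) u := by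
    convert! ((hasDerivAt_pow 2 u).div_const 2).const_sub E using 1
    simp
  convert! (Real.hasDerivAt_log hu.1.ne').add ((hE.log h.ne').const_mul k) using 1
  ring

lemma deriv_logMassFlux_pos (hk : 0 < k) (hu : u ∈ subsonicSpeeds E k) :
    0 < u⁻¹ - k * u / (E - u ^ 2 / 2) := by
  have h := enthalpy_pos hk hu
  have hu0 := hu.1
  rw [sub_pos, inv_eq_one_div, div_lt_div_iff₀ h hu0]
  nlinarith [hu.2]

lemma strictMonoOn_logMassFlux (hk : 0 < k) :
    StrictMonoOn (logMassFlux E k) (subsonicSpeeds E k) := by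
  refine strictMonoOn_of_deriv_pos (convex_subsonicSpeeds hk)
    (fun u hu ↦ (analyticAt_logMassFlux hk hu).continuousAt.continuousWithinAt) fun u hu ↦ ?_
  rw [isOpen_subsonicSpeeds.interior_eq] at hu
  rw [(hasDerivAt_logMassFlux hk hu).deriv]
  exact deriv_logMassFlux_pos hk hu

lemma mem_image_logMassFlux_of_le {y : ℝ} (hk : 0 < k) (hu : u ∈ subsonicSpeeds E k)
    (hy : y ≤ logMassFlux E k u) : y ∈ logMassFlux E k '' subsonicSpeeds E k := by
  set v := min u (Real.exp (y - k * Real.log E)) with hv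
  have hv0 : 0 < v := lt_min hu.1 (Real.exp_pos _)
  have hvS := mem_subsonicSpeeds_of_le hk hu hv0 (min_le_left _ _)
  have hvy : logMassFlux E k v ≤ y := by
    have h1 : Real.log v ≤ y - k * Real.log E := by
      rw [← Real.log_exp (y - k * Real.log E)]
      exact Real.log_le_log hv0 (min_le_right _ _)
    have h2 : Real.log (E - v ^ 2 / 2) ≤ Real.log E :=
      Real.log_le_log (enthalpy_pos hk hvS) (by linarith [sq_nonneg v])
    have h3 := mul_le_mul_of_nonneg_left h2 hk.le
    simp only [logMassFlux]
    linarith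
  have hsub : Icc v u ⊆ subsonicSpeeds E k := fun z hz ↦
    mem_subsonicSpeeds_of_le hk hu (hv0.trans_le hz.1) hz.2
  obtain ⟨z, hz, rfl⟩ := intermediate_value_Icc (min_le_left _ _)
    (fun z hz ↦ (analyticAt_logMassFlux hk (hsub hz)).continuousAt.continuousWithinAt) ⟨hvy, hy⟩
  exact ⟨z, hsub hz, rfl⟩

/-- The speed profile obtained by solving the algebraic conservation laws `r² ρ u = const` for a
flow with Bernoulli constant `E`. -/
lemma exists_analytic_speed {u₀ r₀ : ℝ} (hk : 0 < k) (hu₀ : u₀ ∈ subsonicSpeeds E k)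
    (hr₀ : 0 < r₀) :
    ∃ u : ℝ → ℝ, u r₀ = u₀ ∧ ∀ r, r₀ ≤ r → u r ∈ subsonicSpeeds E k ∧
      logMassFlux E k (u r) + 2 * Real.log r = logMassFlux E k u₀ + 2 * Real.log r₀ ∧
      AnalyticAt ℝ u r ∧
      HasDerivAt u (-(2 / r) / ((u r)⁻¹ - k * u r / (E - (u r) ^ 2 / 2))) r := by
  set F := logMassFlux E k
  set S := subsonicSpeeds E k
  have hinj : InjOn F S := (strictMonoOn_logMassFlux hk).injOn
  refine ⟨fun r ↦ Function.invFunOn F S (F u₀ + 2 * Real.log r₀ - 2 * Real.log r), ?_,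
    fun r hr ↦ ?_⟩
  · simpa using hinj.leftInvOn_invFunOn hu₀
  have hr0 := hr₀.trans_le hr
  have hlog : Real.log r₀ ≤ Real.log r := Real.log_le_log hr₀ hr
  obtain ⟨x, hxS, hx⟩ := mem_image_logMassFlux_of_le
    (y := F u₀ + 2 * Real.log r₀ - 2 * Real.log r) hk hu₀ (by linarith)
  change F x = _ at hx
  have hux : Function.invFunOn F S (F u₀ + 2 * Real.log r₀ - 2 * Real.log r) = x := by
    rw [← hx]; exact hinj.leftInvOn_invFunOn hxS
  have hd := hasDerivAt_logMassFlux hk hxS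
  have hpos := deriv_logMassFlux_pos hk hxS
  have hA := analyticAt_logMassFlux hk hxS
  have hg : AnalyticAt ℝ (Function.invFunOn F S)
      (F u₀ + 2 * Real.log r₀ - 2 * Real.log r) := by
    rw [← hx]
    exact hA.analyticAt_invFunOn (by rw [hd.deriv]; exact hpos.ne') isOpen_subsonicSpeeds hinj hxS
  have hgd : HasDerivAt (Function.invFunOn F S) (x⁻¹ - k * x / (E - x ^ 2 / 2))⁻¹
      (F u₀ + 2 * Real.log r₀ - 2 * Real.log r) := by
    have hst : HasStrictDerivAt F (x⁻¹ - k * x / (E - x ^ 2 / 2)) x := by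
      simpa [hd.deriv] using hA.hasStrictDerivAt
    rw [← hx]
    refine (hst.to_local_left_inverse hpos.ne' ?_).hasDerivAt
    filter_upwards [isOpen_subsonicSpeeds.mem_nhds hxS] with z hz
      using hinj.leftInvOn_invFunOn hz
  have hl : AnalyticAt ℝ (fun r ↦ F u₀ + 2 * Real.log r₀ - 2 * Real.log r) r :=
    analyticAt_const.sub (analyticAt_const.mul (analyticAt_log hr0))
  have hld : HasDerivAt (fun r ↦ F u₀ + 2 * Real.log r₀ - 2 * Real.log r) (-(2 / r)) r := by
    convert! ((Real.hasDerivAt_log hr0.ne').const_mul 2).const_sub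
      (F u₀ + 2 * Real.log r₀) using 1
  simp only [hux]
  refine ⟨hxS, by rw [hx]; ring, hg.comp_of_eq hl rfl, ?_⟩
  convert! hgd.comp r hld using 1
  rw [div_eq_mul_inv, mul_comm]

end logMassFlux

lemma eq_left_of_hasDerivWithinAt_zero {f : ℝ → ℝ} {a b : ℝ} (hab : a < b)
    (hf : ∀ x ∈ Icc a b, HasDerivWithinAt f 0 (Icc a b) x) {x : ℝ} (hx : x ∈ Icc a b) :
    f x = f a :=
  constant_of_derivWithin_zero (fun y hy ↦ (hf y hy).differentiableWithinAt)
    (fun y hy ↦ (hf y (Ico_subset_Icc_self hy)).derivWithin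
      (uniqueDiffOn_Icc hab y (Ico_subset_Icc_self hy))) x hx

section conservationLaws

variable {γ r₀ r₁ u₀ ρ₀ p₀ k : ℝ} {u ρ p : ℝ → ℝ}

lemma IsSubsonicRadialSolution.sq_lt (h : IsSubsonicRadialSolution γ r₀ r₁ u₀ ρ₀ p₀ u ρ p)
    {r : ℝ} (hr : r ∈ Icc r₀ r₁) : (u r) ^ 2 < γ * p r / ρ r :=
  (Real.lt_sqrt (h.2.2.2.1 r hr).2.2.1.le).1 (h.2.2.2.1 r hr).2.2.2

lemma IsSubsonicRadialSolution.denominator_ne_zero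
    (h : IsSubsonicRadialSolution γ r₀ r₁ u₀ ρ₀ p₀ u ρ p) (h0 : 0 < r₀) {r : ℝ}
    (hr : r ∈ Icc r₀ r₁) : r * ((u r) ^ 2 - γ * p r / ρ r) ≠ 0 :=
  mul_ne_zero (h0.trans_le hr.1).ne' (sub_ne_zero.2 (h.sq_lt hr).ne)

/-- Conservation of the Bernoulli function. -/
lemma IsSubsonicRadialSolution.bernoulli_eq
    (h : IsSubsonicRadialSolution γ r₀ r₁ u₀ ρ₀ p₀ u ρ p) (h0 : 0 < r₀) (h01 : r₀ < r₁)
    (hkγ : k * (γ - 1) = 1) {r : ℝ} (hr : r ∈ Icc r₀ r₁) :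
    (u r) ^ 2 / 2 + k * (γ * p r / ρ r) = u₀ ^ 2 / 2 + k * (γ * p₀ / ρ₀) := by
  obtain ⟨-, -, -, hpos, hode, hu0, hρ0, hp0⟩ := id h
  rw [← hu0, ← hρ0, ← hp0]
  refine eq_left_of_hasDerivWithinAt_zero
    (f := fun r ↦ (u r) ^ 2 / 2 + k * (γ * p r / ρ r)) h01 (fun r hr ↦ ?_) hr
  obtain ⟨hu, hρ, hp⟩ := hode r hr
  have hD := h.denominator_ne_zero h0 hr
  have hρr := (hpos r hr).1.ne'
  generalize r * ((u r) ^ 2 - γ * p r / ρ r) = D at hD hu hρ hp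
  convert! ((hu.pow 2).div_const 2).add (((hp.const_mul γ).div hρ hρr).const_mul k) using 1
  field_simp
  linear_combination (2 * (u r) ^ 2 * p r * γ) * hkγ

/-- Conservation of the mass flux. -/
lemma IsSubsonicRadialSolution.massFlux_eq
    (h : IsSubsonicRadialSolution γ r₀ r₁ u₀ ρ₀ p₀ u ρ p) (h0 : 0 < r₀) (h01 : r₀ < r₁)
    {r : ℝ} (hr : r ∈ Icc r₀ r₁) : r ^ 2 * (ρ r * u r) = r₀ ^ 2 * (ρ₀ * u₀) := by
  obtain ⟨-, -, -, hpos, hode, hu0, hρ0, hp0⟩ := id h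
  rw [← hu0, ← hρ0]
  refine eq_left_of_hasDerivWithinAt_zero
    (f := fun r ↦ r ^ 2 * (ρ r * u r)) h01 (fun r hr ↦ ?_) hr
  obtain ⟨hu, hρ, -⟩ := hode r hr
  have hr0 := (h0.trans_le hr.1).ne'
  have hd := sub_ne_zero.2 (h.sq_lt hr).ne
  generalize γ * p r / ρ r = c at hd hu hρ
  convert! ((hasDerivWithinAt_id r _).pow 2).mul (hρ.mul hu) using 1
  simp only [id, Pi.mul_apply, Pi.pow_apply]
  field_simp
  ring

/-- Along a subsonic solution the logarithm of the mass flux, expressed through the speed and the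
Bernoulli constant, is conserved. -/
lemma IsSubsonicRadialSolution.logMassFlux_eq {E : ℝ}
    (h : IsSubsonicRadialSolution γ r₀ r₁ u₀ ρ₀ p₀ u ρ p) (h0 : 0 < r₀) (h01 : r₀ < r₁)
    (hk : 0 < k) (hkγ : k * (γ - 1) = 1) (hE : E = u₀ ^ 2 / 2 + k * (γ * p₀ / ρ₀)) {r : ℝ}
    (hr : r ∈ Icc r₀ r₁) : u r ∈ subsonicSpeeds E k ∧
      logMassFlux E k (u r) + 2 * Real.log r = logMassFlux E k u₀ + 2 * Real.log r₀ := by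
  obtain ⟨-, -, -, hpos, hode, hu0, -, -⟩ := id h
  have hmem : ∀ r ∈ Icc r₀ r₁, u r ∈ subsonicSpeeds E k := fun r hr ↦ by
    have h1 := h.bernoulli_eq h0 h01 hkγ hr
    have h2 := mul_lt_mul_of_pos_left (h.sq_lt hr) hk
    exact ⟨(hpos r hr).2.2.1, by linarith⟩
  refine ⟨hmem r hr, ?_⟩
  rw [← hu0]
  refine eq_left_of_hasDerivWithinAt_zero
    (f := fun r ↦ logMassFlux E k (u r) + 2 * Real.log r) h01 (fun r hr ↦ ?_) hr
  have hu := (hode r hr).1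
  have hr0 := (h0.trans_le hr.1).ne'
  have hd := sub_ne_zero.2 (h.sq_lt hr).ne
  have hB : E - (u r) ^ 2 / 2 = k * (γ * p r / ρ r) := by
    linarith [h.bernoulli_eq h0 h01 hkγ hr]
  have hc : γ * p r / ρ r ≠ 0 := ((sq_nonneg _).trans_lt (h.sq_lt hr)).ne'
  have hur := (hpos r hr).2.2.1.ne'
  have hF := hasDerivAt_logMassFlux hk (hmem r hr)
  rw [hB] at hF
  generalize γ * p r / ρ r = c at hd hu hF hc
  convert! (hF.comp_hasDerivWithinAt r hu).add
    (((Real.hasDerivAt_log hr0).const_mul 2).hasDerivWithinAt (s := Icc r₀ r₁)) using 1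
  field_simp
  ring

theorem IsSubsonicRadialSolution.unique {u' ρ' p' : ℝ → ℝ} (hγ : 1 < γ)
    (h0 : 0 < r₀) (h01 : r₀ < r₁) (h : IsSubsonicRadialSolution γ r₀ r₁ u₀ ρ₀ p₀ u ρ p)
    (h' : IsSubsonicRadialSolution γ r₀ r₁ u₀ ρ₀ p₀ u' ρ' p') {r : ℝ} (hr : r ∈ Icc r₀ r₁) :
    u' r = u r ∧ ρ' r = ρ r ∧ p' r = p r := by
  have hk : 0 < (γ - 1)⁻¹ := inv_pos.2 (sub_pos.2 hγ)
  have hkγ : (γ - 1)⁻¹ * (γ - 1) = 1 := inv_mul_cancel₀ (sub_pos.2 hγ).ne'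
  have hr2 : r ^ 2 ≠ 0 := pow_ne_zero 2 (h0.trans_le hr.1).ne'
  obtain ⟨hρr, -, hur, -⟩ := h.2.2.2.1 r hr
  obtain ⟨hmem, hF⟩ := h.logMassFlux_eq h0 h01 hk hkγ rfl hr
  obtain ⟨hmem', hF'⟩ := h'.logMassFlux_eq h0 h01 hk hkγ rfl hr
  have hu : u' r = u r :=
    (strictMonoOn_logMassFlux hk).injOn hmem' hmem (by linarith)
  have hm := (h'.massFlux_eq h0 h01 hr).trans (h.massFlux_eq h0 h01 hr).symm
  have hB := (h'.bernoulli_eq h0 h01 hkγ hr).trans (h.bernoulli_eq h0 h01 hkγ hr).symm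
  rw [hu] at hm hB
  have hρ : ρ' r = ρ r := mul_right_cancel₀ hur.ne' (mul_left_cancel₀ hr2 hm)
  rw [hρ] at hB
  have hc := mul_left_cancel₀ hk.ne' (add_left_cancel hB)
  exact ⟨hu, hρ, mul_left_cancel₀ (zero_lt_one.trans hγ).ne' ((div_left_inj' hρr.ne').1 hc)⟩

end conservationLaws

theorem exists_isSubsonicRadialSolution {γ r₀ r₁ u₀ ρ₀ p₀ : ℝ} (hγ : 1 < γ) (h0 : 0 < r₀)
    (h01 : r₀ < r₁) (hu₀ : 0 < u₀) (hρ₀ : 0 < ρ₀) (hsub : u₀ ^ 2 < γ * p₀ / ρ₀) :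
    ∃ u ρ p : ℝ → ℝ, IsSubsonicRadialSolution γ r₀ r₁ u₀ ρ₀ p₀ u ρ p ∧
      AnalyticOn ℝ u (Icc r₀ r₁) ∧ AnalyticOn ℝ ρ (Icc r₀ r₁) ∧ AnalyticOn ℝ p (Icc r₀ r₁) := by
  have hγ0 : 0 < γ := zero_lt_one.trans hγ
  obtain ⟨k, hk, hkγ⟩ : ∃ k : ℝ, 0 < k ∧ k * (γ - 1) = 1 :=
    ⟨(γ - 1)⁻¹, inv_pos.2 (sub_pos.2 hγ), inv_mul_cancel₀ (sub_pos.2 hγ).ne'⟩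
  obtain ⟨E, hE⟩ : ∃ E : ℝ, E = u₀ ^ 2 / 2 + k * (γ * p₀ / ρ₀) := ⟨_, rfl⟩
  have hmem₀ : u₀ ∈ subsonicSpeeds E k :=
    ⟨hu₀, by linarith [mul_lt_mul_of_pos_left hsub hk]⟩
  obtain ⟨u, huu₀, hu⟩ := exists_analytic_speed hk hmem₀ h0
  set m := r₀ ^ 2 * (ρ₀ * u₀) with hm
  have hm0 : 0 < m := by positivity
  set ρ : ℝ → ℝ := fun r ↦ m / (r ^ 2 * u r) with hρ
  set p : ℝ → ℝ := fun r ↦ ρ r * ((E - (u r) ^ 2 / 2) / (k * γ)) with hp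
  have hAu : AnalyticOn ℝ u (Icc r₀ r₁) := fun r hr ↦ (hu r hr.1).2.2.1.analyticWithinAt
  have hAρ : AnalyticOn ℝ ρ (Icc r₀ r₁) :=
    analyticOn_const.div ((analyticOn_id.pow 2).mul hAu) fun r hr ↦
      (mul_pos (pow_pos (h0.trans_le hr.1) 2) (hu r hr.1).1.1).ne'
  have hAp : AnalyticOn ℝ p (Icc r₀ r₁) :=
    hAρ.mul ((analyticOn_const.sub ((hAu.pow 2).div_const)).div_const)
  have hρpos : ∀ r ∈ Icc r₀ r₁, 0 < ρ r := fun r hr ↦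
    div_pos hm0 (mul_pos (pow_pos (h0.trans_le hr.1) 2) (hu r hr.1).1.1)
  have hc : ∀ r ∈ Icc r₀ r₁, γ * p r / ρ r = (E - (u r) ^ 2 / 2) / k := fun r hr ↦ by
    have := (hρpos r hr).ne'
    simp only [hp]
    field_simp
  refine ⟨u, ρ, p, ⟨hAu.contDiffOn (uniqueDiffOn_Icc h01), hAρ.contDiffOn (uniqueDiffOn_Icc h01),
    hAp.contDiffOn (uniqueDiffOn_Icc h01), fun r hr ↦ ?_, fun r hr ↦ ?_, huu₀, ?_, ?_⟩,
    hAu, hAρ, hAp⟩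
  · have hur := (hu r hr.1).1
    have hh := enthalpy_pos hk hur
    refine ⟨hρpos r hr, mul_pos (hρpos r hr) (by positivity), hur.1, ?_⟩
    rw [hc r hr, Real.lt_sqrt hur.1.le, lt_div_iff₀ hk]
    linarith [hur.2]
  · obtain ⟨hur, -, -, hd⟩ := hu r hr.1
    have hr0 := h0.trans_le hr.1
    have hu0 := hur.1
    rw [hc r hr]
    obtain ⟨c, hcE⟩ : ∃ c, (E - (u r) ^ 2 / 2) / k = c := ⟨_, rfl⟩
    have hEc : E - (u r) ^ 2 / 2 = k * c := by rw [← hcE]; field_simp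
    have hc0 : 0 < c := hcE ▸ div_pos (enthalpy_pos hk hur) hk
    have hcu : u r ^ 2 - c ≠ 0 := by
      have : k * (u r ^ 2) < k * c := by linarith [hur.2]
      linarith [lt_of_mul_lt_mul_left this hk.le]
    have hd' : HasDerivAt u (2 * c * u r / (r * (u r ^ 2 - c))) r := by
      convert! hd using 1
      rw [hEc]
      have h1 : (u r)⁻¹ - k * u r / (k * c) = -((u r ^ 2 - c) / (u r * c)) := by
        field_simp
        ring
      rw [h1]
      field_simp
    have hdρ : HasDerivAt ρ (-(2 * ρ r * u r ^ 2) / (r * (u r ^ 2 - c))) r := by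
      convert! (hasDerivAt_const r m).div (((hasDerivAt_id r).pow 2).mul hd') (by
        simpa using ⟨hr0.ne', hu0.ne'⟩) using 1
      simp only [hρ, id, Pi.mul_apply, Pi.pow_apply]
      field_simp
      ring
    have hdp : HasDerivAt p (-(2 * ρ r * c * u r ^ 2) / (r * (u r ^ 2 - c))) r := by
      convert! hdρ.mul ((((hd'.pow 2).div_const 2).const_sub E).div_const (k * γ)) using 1
      simp only [Pi.pow_apply]
      rw [hEc]
      field_simp
      linear_combination (-(2 * ρ r * u r)) * hkγ
    rw [hcE]
    exact ⟨hd'.hasDerivWithinAt, hdρ.hasDerivWithinAt, hdp.hasDerivWithinAt⟩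
  · simp only [hρ, huu₀, hm]
    field_simp
  · have hρr : ρ r₀ = ρ₀ := by
      simp only [hρ, huu₀, hm]
      field_simp
    simp only [hp, hρr, huu₀, hE]
    field_simp
    ring

lemma sq_soundSpeed_eq {γ p A : ℝ} (hγ : 1 < γ) (hp : 0 < p) (hA : 0 < A) :
    γ * p / (p / A) ^ (1 / γ) = γ * (A ^ (1 / γ) * p ^ ((γ - 1) / γ)) := by
  have hγ0 : γ ≠ 0 := (zero_lt_one.trans hγ).ne'
  have h : p ^ ((γ - 1) / γ) * p ^ (1 / γ) = p := by
    rw [← Real.rpow_add hp, ← add_div, sub_add_cancel, div_self hγ0, Real.rpow_one]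
  have h1 : 0 < A ^ (1 / γ) := Real.rpow_pos_of_pos hA _
  have h2 : 0 < p ^ (1 / γ) := Real.rpow_pos_of_pos hp _
  rw [Real.div_rpow hp.le hA.le, div_div_eq_mul_div, div_eq_iff h2.ne']
  linear_combination (-(γ * A ^ (1 / γ))) * h

/-- The lower bound on the entry pressure says that the entry state is subsonic. -/
lemma lt_sq_soundSpeed {γ p A E : ℝ} (hγ : 1 < γ) (hp : 0 < p) (hA : 0 < A) (hE : 0 < E)
    (h : ((2 / γ) * ((γ - 1) / (γ + 1))) ^ (γ / (γ - 1)) * E ^ (γ / (γ - 1))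
      * A ^ (-(1 / (γ - 1))) < p) :
    2 * ((γ - 1) / (γ + 1)) * E < γ * (A ^ (1 / γ) * p ^ ((γ - 1) / γ)) := by
  have hγ0 : 0 < γ := zero_lt_one.trans hγ
  have hγ1 : 0 < γ - 1 := sub_pos.2 hγ
  have hB : 0 < (2 / γ) * ((γ - 1) / (γ + 1)) := by positivity
  have hlt := Real.rpow_lt_rpow (z := (γ - 1) / γ) (by positivity) h (by positivity)
  have he : γ / (γ - 1) * ((γ - 1) / γ) = 1 := by field_simp
  have he' : -(1 / (γ - 1)) * ((γ - 1) / γ) = -(1 / γ) := by field_simp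
  rw [Real.mul_rpow (by positivity) (by positivity), Real.mul_rpow (by positivity) (by positivity),
    ← Real.rpow_mul hB.le, ← Real.rpow_mul hE.le, ← Real.rpow_mul hA.le, he, he', Real.rpow_one,
    Real.rpow_one, Real.rpow_neg hA.le, ← div_eq_mul_inv,
    div_lt_iff₀ (Real.rpow_pos_of_pos hA _)] at hlt
  calc 2 * ((γ - 1) / (γ + 1)) * E = γ * ((2 / γ) * ((γ - 1) / (γ + 1)) * E) := by field_simp
    _ < γ * (p ^ ((γ - 1) / γ) * A ^ (1 / γ)) := mul_lt_mul_of_pos_left hlt hγ0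
    _ = _ := by ring

/-- Existence, uniqueness and analyticity of the spherically symmetric subsonic flow
with subsonic entry data (Lemma 3.1). -/
theorem symmetric_subsonic_flow_exists_unique
    (γ r₀ r₁ p₀ A₁ E₁ ρ₀ c₀sq u₀ : ℝ)
    (hγ : 1 < γ) (h0 : 0 < r₀) (h01 : r₀ < r₁)
    (hp₀ : 0 < p₀) (hA₁ : 0 < A₁)
    (hE : E₁ > (γ / (γ - 1)) * A₁ ^ (1 / γ : ℝ) * p₀ ^ ((γ - 1) / γ : ℝ))
    (hsub : p₀ > ((2 / γ) * ((γ - 1) / (γ + 1))) ^ (γ / (γ - 1) : ℝ)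
      * E₁ ^ (γ / (γ - 1) : ℝ) * A₁ ^ (-(1 / (γ - 1)) : ℝ))
    (hρ₀ : ρ₀ = (p₀ / A₁) ^ (1 / γ : ℝ))
    (hc₀ : c₀sq = γ * p₀ / ρ₀)
    (hu₀ : u₀ = Real.sqrt (2 * (E₁ - c₀sq / (γ - 1)))) :
    ∃ u ρ p : ℝ → ℝ,
      IsSubsonicRadialSolution γ r₀ r₁ u₀ ρ₀ p₀ u ρ p ∧
      (∀ u' ρ' p' : ℝ → ℝ, IsSubsonicRadialSolution γ r₀ r₁ u₀ ρ₀ p₀ u' ρ' p' →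
        ∀ r ∈ Set.Icc r₀ r₁, u' r = u r ∧ ρ' r = ρ r ∧ p' r = p r) ∧
      AnalyticOn ℝ u (Set.Icc r₀ r₁) ∧ AnalyticOn ℝ ρ (Set.Icc r₀ r₁) ∧
      AnalyticOn ℝ p (Set.Icc r₀ r₁) := by
  have hγ1 : 0 < γ - 1 := sub_pos.2 hγ
  have hc : c₀sq = γ * (A₁ ^ (1 / γ) * p₀ ^ ((γ - 1) / γ)) := by
    rw [hc₀, hρ₀, sq_soundSpeed_eq hγ hp₀ hA₁]
  have hc0 : 0 < c₀sq := by rw [hc]; positivity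
  have hEc : c₀sq / (γ - 1) < E₁ := by
    rw [hc]
    convert hE using 1
    ring
  have hE0 : 0 < E₁ := (div_pos hc0 hγ1).trans hEc
  have hlt := lt_sq_soundSpeed hγ hp₀ hA₁ hE0 hsub
  rw [← hc] at hlt
  have hu₀pos : 0 < u₀ := by
    rw [hu₀]
    exact Real.sqrt_pos.2 (by linarith)
  have hu₀c : u₀ ^ 2 < γ * p₀ / ρ₀ := by
    rw [hu₀, Real.sq_sqrt (by linarith), ← hc₀]
    have h1 : 2 * E₁ < c₀sq * ((γ + 1) / (γ - 1)) := by
      rw [mul_div_assoc', lt_div_iff₀ hγ1]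
      calc 2 * E₁ * (γ - 1) = 2 * ((γ - 1) / (γ + 1)) * E₁ * (γ + 1) := by field_simp
        _ < c₀sq * (γ + 1) := mul_lt_mul_of_pos_right hlt (by linarith)
    have h2 : c₀sq * ((γ + 1) / (γ - 1)) = c₀sq + 2 * (c₀sq / (γ - 1)) := by
      field_simp
      ring
    linarith
  have hρ₀pos : 0 < ρ₀ := hρ₀ ▸ Real.rpow_pos_of_pos (div_pos hp₀ hA₁) _
  obtain ⟨u, ρ, p, h, hu, hρ, hp⟩ :=
    exists_isSubsonicRadialSolution hγ h0 h01 hu₀pos hρ₀pos hu₀c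
  exact ⟨u, ρ, p, h, fun u' ρ' p' h' r hr ↦ h.unique hγ h0 h01 h' hr, hu, hρ, hp⟩
end
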